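/- For every integer r ≥ 1, the following identity of rational functions in t over ℚ holds: (1/(1−t²)³)·[ 2t^{8r−5}/((1−t³)(1−t^{4r−3})(1−t^{4r−2})) + 2t^{12r−8}/((1−t^{4r−3})²(1−t^{4r−2})) + t^{8r−6}/(1−t^{4r−3})² ] + (2/((1−t²)²(1−t⁴)))·[ t^{4r−3}/((1−t³)(1−t^{4r−3})) + t^{4r−2}/((1−t³)(1−t^{4r−2})) + t^{8r−5}/((1−t^{4r−3})(1−t^{4r−2})) ] + (1+t³)/((1−t²)(1−t³)(1−t⁴)(1−t⁶)) = (1−t^{4r})·(1 + t^{4r−2} + 2t^{4r−1} + t^{4r} + t^{8r−2}) / ((1−t²)(1−t³)²(1−t⁴)(1−t^{4r−3})²(1−t^{4r−2})). -/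

import Mathlib

open RatFunc

set_option maxHeartbeats 4000000

/-- The field identity behind the Hilbert series computation, with `s` in the role of
`t ^ (4 * r - 3)`. -/
theorem monopole_sum_eq {K : Type*} [Field K] (t s : K) (h₂ : 1 - t ^ 2 ≠ 0)
    (h₄ : 1 - t ^ 4 ≠ 0) (h₆ : 1 - t ^ 6 ≠ 0) (hs : 1 - s ≠ 0) (hst : 1 - s * t ≠ 0) :
    (1 / (1 - t ^ 2) ^ 3) *
        (2 * (s ^ 2 * t) / ((1 - t ^ 3) * (1 - s) * (1 - s * t))
          + 2 * (s ^ 3 * t) / ((1 - s) ^ 2 * (1 - s * t))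
          + s ^ 2 / (1 - s) ^ 2)
      + (2 / ((1 - t ^ 2) ^ 2 * (1 - t ^ 4))) *
        (s / ((1 - t ^ 3) * (1 - s))
          + s * t / ((1 - t ^ 3) * (1 - s * t))
          + s ^ 2 * t / ((1 - s) * (1 - s * t)))
      + (1 + t ^ 3) / ((1 - t ^ 2) * (1 - t ^ 3) * (1 - t ^ 4) * (1 - t ^ 6)) =
      (1 - s * t ^ 3) * (1 + s * t + 2 * (s * t ^ 2) + s * t ^ 3 + s ^ 2 * t ^ 4)
        / ((1 - t ^ 2) * (1 - t ^ 3) ^ 2 * (1 - t ^ 4) * (1 - s) ^ 2 * (1 - s * t)) := by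
  have e₄ : 1 - t ^ 4 = (1 - t ^ 2) * (1 + t ^ 2) := by ring
  have e₆ : 1 - t ^ 6 = (1 - t ^ 3) * (1 + t ^ 3) := by ring
  rw [e₄] at h₄ ⊢
  rw [e₆] at h₆ ⊢
  have h₄' := right_ne_zero_of_mul h₄
  have h₃ := left_ne_zero_of_mul h₆
  have h₃' := right_ne_zero_of_mul h₆
  have hts : 1 - t * s ≠ 0 := by rwa [mul_comm]
  field_simp
  ring

theorem RatFunc.one_sub_X_pow_ne_zero {K : Type*} [Field K] {n : ℕ} (hn : n ≠ 0) :
    (1 - X ^ n : RatFunc K) ≠ 0 := by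
  have h : (1 - Polynomial.X ^ n : Polynomial K) ≠ 0 := by
    rw [← neg_ne_zero, neg_sub]
    exact (Polynomial.monic_X_pow_sub_C (1 : K) hn).ne_zero
  simpa using RatFunc.algebraMap_ne_zero h

/-- The summation identity computing the Hilbert series `H'(t)` of the Coulomb branch
`M_C(r,3,1)` by the monopole formula, as rational functions in `t` over `ℚ`. -/
theorem hilbert_series_identity_rank_three (r : ℕ) (hr : 1 ≤ r) :
    ((1 / (1 - X ^ 2) ^ 3) *
        (2 * X ^ (8 * r - 5) / ((1 - X ^ 3) * (1 - X ^ (4 * r - 3)) * (1 - X ^ (4 * r - 2)))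
          + 2 * X ^ (12 * r - 8) / ((1 - X ^ (4 * r - 3)) ^ 2 * (1 - X ^ (4 * r - 2)))
          + X ^ (8 * r - 6) / (1 - X ^ (4 * r - 3)) ^ 2)
      + (2 / ((1 - X ^ 2) ^ 2 * (1 - X ^ 4))) *
        (X ^ (4 * r - 3) / ((1 - X ^ 3) * (1 - X ^ (4 * r - 3)))
          + X ^ (4 * r - 2) / ((1 - X ^ 3) * (1 - X ^ (4 * r - 2)))
          + X ^ (8 * r - 5) / ((1 - X ^ (4 * r - 3)) * (1 - X ^ (4 * r - 2))))
      + (1 + X ^ 3) / ((1 - X ^ 2) * (1 - X ^ 3) * (1 - X ^ 4) * (1 - X ^ 6)) : RatFunc ℚ) =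
      (1 - X ^ (4 * r)) * (1 + X ^ (4 * r - 2) + 2 * X ^ (4 * r - 1) + X ^ (4 * r) + X ^ (8 * r - 2))
        / ((1 - X ^ 2) * (1 - X ^ 3) ^ 2 * (1 - X ^ 4)
            * (1 - X ^ (4 * r - 3)) ^ 2 * (1 - X ^ (4 * r - 2))) := by
  obtain ⟨k, rfl⟩ := Nat.exists_eq_add_of_le' hr
  have key := monopole_sum_eq (X : RatFunc ℚ) (X ^ (4 * k + 1))
    (one_sub_X_pow_ne_zero two_ne_zero) (one_sub_X_pow_ne_zero four_ne_zero)
    (one_sub_X_pow_ne_zero (by decide)) (one_sub_X_pow_ne_zero (by lia))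
    (by rw [← pow_succ]; exact one_sub_X_pow_ne_zero (by lia))
  simp only [← pow_mul, ← pow_add, ← pow_succ] at key
  convert key using 6 <;> congr 3 <;> lia
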